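/- Let ω be a finitely dominated end of a graph G and X ⊆ V finite. Then X can be separated from ω by a set T ⊆ V with |T| ≤ deg(ω) + dom(ω). -/

import Mathlib

open Set

universe u

/-- A separation of a graph `G`: a pair of vertex sets covering `V` with no
edge between `A \ B` and `B \ A`. -/
structure Separation {V : Type u} (G : SimpleGraph V) where
  A : Set V
  B : Set V
  union_eq : A ∪ B = Set.univ
  no_edge : ∀ a ∈ A \ B, ∀ b ∈ B \ A, ¬ G.Adj a b

/-- The oriented separations of finite order. -/
abbrev FinSep {V : Type u} (G : SimpleGraph V) := {s : Separation G // (s.A ∩ s.B).Finite}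

/-- The separation topology: basic open sets prescribe the restriction of a
separation to a finite vertex set `Z`. -/
instance sepTop {V : Type u} (G : SimpleGraph V) : TopologicalSpace (FinSep G) :=
  TopologicalSpace.generateFrom
    {O | ∃ Z AZ BZ : Set V, Z.Finite ∧
      O = {s : FinSep G | s.1.A ∩ Z = AZ ∧ s.1.B ∩ Z = BZ}}

/-- The reverse orientation of a finite-order separation. -/
def FinSep.rev {V : Type u} {G : SimpleGraph V} (s : FinSep G) : FinSep G :=
  ⟨⟨s.1.B, s.1.A, by rw [Set.union_comm]; exact s.1.union_eq,
    fun a ha b hb h => s.1.no_edge b hb a ha h.symm⟩,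
   by rw [Set.inter_comm]; exact s.2⟩

/-- A ray in a graph: an injective sequence of successively adjacent vertices. -/
structure GraphRay {V : Type u} (G : SimpleGraph V) where
  f : ℕ → V
  inj : Function.Injective f
  adj : ∀ n, G.Adj (f n) (f (n + 1))

/-- Two rays are equivalent if no finite vertex set separates them. -/
def RayEquiv {V : Type u} (G : SimpleGraph V) (R R' : GraphRay G) : Prop :=
  ∀ F : Set V, F.Finite →
    ∃ (m n : ℕ) (w : G.Walk (R.f m) (R'.f n)), ∀ x ∈ w.support, x ∉ F

/-- An end of a graph: a (nonempty) equivalence class of rays. -/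
structure GraphEnd {V : Type u} (G : SimpleGraph V) where
  rays : Set (GraphRay G)
  nonempty : rays.Nonempty
  mem_iff : ∀ R ∈ rays, ∀ R', R' ∈ rays ↔ RayEquiv G R R'

/-- A ray has a tail in `B`. -/
def HasTailIn {V : Type u} {G : SimpleGraph V} (R : GraphRay G) (B : Set V) : Prop :=
  ∃ N, ∀ n ≥ N, R.f n ∈ B

/-- The end tangle induced by the end `ω`: all finite-order separations `(A,B)`
such that every ray of `ω` has a tail in `B`. -/
def endTangle {V : Type u} {G : SimpleGraph V} (ω : GraphEnd G) : Set (FinSep G) :=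
  {s | ∀ R ∈ ω.rays, HasTailIn R s.1.B}

/-- `v` dominates the end `ω`: `v` sends infinitely many paths to a ray of `ω`
which pairwise meet only in `v`. -/
def Dominates {V : Type u} (G : SimpleGraph V) (v : V) (ω : GraphEnd G) : Prop :=
  ∃ R ∈ ω.rays, ∃ p : ℕ → (n : ℕ) × G.Walk v (R.f n),
    (∀ i, (p i).2.IsPath) ∧ (Function.Injective fun i => (p i).1) ∧
    ∀ i j, i ≠ j → ∀ x, x ∈ (p i).2.support → x ∈ (p j).2.support → x = v

/-- The end `ω` has (vertex) degree at least `m`: there are `m` pairwise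
disjoint rays belonging to `ω`. -/
def DegGE {V : Type u} (G : SimpleGraph V) (ω : GraphEnd G) (m : ℕ) : Prop :=
  ∃ R : Fin m → GraphRay G, (∀ i, R i ∈ ω.rays) ∧
    ∀ i j, i ≠ j → Disjoint (Set.range (R i).f) (Set.range (R j).f)

/-- At least `n` vertices dominate `ω`. -/
def DomGE {V : Type u} (G : SimpleGraph V) (ω : GraphEnd G) (n : ℕ) : Prop :=
  ∃ D : Finset V, D.card = n ∧ ∀ v ∈ D, Dominates G v ω

/-- `deg(ω) + dom(ω) ≥ k`. -/
def DegDomGE {V : Type u} (G : SimpleGraph V) (ω : GraphEnd G) (k : ℕ) : Prop :=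
  ∃ m n, m + n = k ∧ DegGE G ω m ∧ DomGE G ω n

/-- `T` separates `X` from the end `ω`: every ray of `ω` meeting `X` meets `T`. -/
def SeparatesFromEnd {V : Type u} (G : SimpleGraph V) (X T : Set V) (ω : GraphEnd G) : Prop :=
  ∀ R ∈ ω.rays, (∃ n, R.f n ∈ X) → ∃ n, R.f n ∈ T

/-- `K` is `(<ℵ₀)`-inseparable (apart from the infiniteness requirement): no
finite-order separation separates two of its vertices. -/
def FinInseparable {V : Type u} (G : SimpleGraph V) (K : Set V) : Prop :=
  ∀ s : FinSep G, ∀ x ∈ K, ∀ y ∈ K, ¬(x ∈ s.1.A \ s.1.B ∧ y ∈ s.1.B \ s.1.A)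

/-- An `ℵ₀`-block: a maximal infinite set of vertices no two of which can be
separated by a finite-order separation. -/
def Aleph0Block {V : Type u} (G : SimpleGraph V) (K : Set V) : Prop :=
  K.Infinite ∧ FinInseparable G K ∧
    ∀ K' : Set V, K ⊆ K' → K'.Infinite → FinInseparable G K' → K' = K

/-- Every infinite ray eventually leaves a finite set. -/
theorem GraphRay.eventually_notMem {V : Type u} {G : SimpleGraph V} (R : GraphRay G)
    {F : Set V} (hF : F.Finite) : ∃ N, ∀ n ≥ N, R.f n ∉ F := by
  obtain ⟨N, hN⟩ := (hF.preimage (R.inj.injOn (s := R.f ⁻¹' F))).bddAbove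
  exact ⟨N + 1, fun n hn h => by have := hN h; omega⟩

/-- The tail of a ray from its `k`-th vertex on. -/
def GraphRay.drop {V : Type u} {G : SimpleGraph V} (R : GraphRay G) (k : ℕ) : GraphRay G where
  f n := R.f (n + k)
  inj a b h := by simpa using R.inj h
  adj n := by
    have := R.adj (n + k)
    rwa [show n + k + 1 = n + 1 + k by omega] at this

/-- Prepending a new vertex to a ray. -/
def GraphRay.cons {V : Type u} {G : SimpleGraph V} (R : GraphRay G) (v : V)
    (h : G.Adj v (R.f 0)) (hv : ∀ n, R.f n ≠ v) : GraphRay G where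
  f n := Nat.casesOn n v R.f
  inj a b hab := by
    cases a <;> cases b
    · rfl
    · exact absurd hab.symm (hv _)
    · exact absurd hab (hv _)
    · exact congrArg _ (R.inj hab)
  adj n := by
    cases n
    · exact h
    · exact R.adj _

namespace GraphEnd

variable {V : Type u} {G : SimpleGraph V} (ω : GraphEnd G)

theorem mem_rays_of_common_tail {R R' : GraphRay G} (hR : R ∈ ω.rays) (a b : ℕ)
    (h : ∀ n, R'.f (n + a) = R.f (n + b)) : R' ∈ ω.rays := by
  rw [ω.mem_iff R hR]
  intro F hF
  obtain ⟨N, hN⟩ := R.eventually_notMem hF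
  refine ⟨N + b, N + a, SimpleGraph.Walk.nil.copy rfl (h N).symm, ?_⟩
  intro x hx
  simp only [SimpleGraph.Walk.support_copy, SimpleGraph.Walk.support_nil,
    List.mem_singleton] at hx
  subst hx
  exact hN _ (by omega)

theorem drop_mem_rays {R : GraphRay G} (hR : R ∈ ω.rays) (k : ℕ) : R.drop k ∈ ω.rays :=
  ω.mem_rays_of_common_tail hR 0 k fun _ => rfl

/-- The vertices at which some ray of `ω` avoiding `T` starts. -/
def reach (T : Set V) : Set V :=
  {v | ∃ R ∈ ω.rays, R.f 0 = v ∧ ∀ n, R.f n ∉ T}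

variable {ω}

theorem mem_reach_of_ray {R : GraphRay G} (hR : R ∈ ω.rays) {T : Set V} {k : ℕ}
    (h : ∀ n ≥ k, R.f n ∉ T) : R.f k ∈ ω.reach T :=
  ⟨R.drop k, ω.drop_mem_rays hR k, by simp [GraphRay.drop], fun n => h _ (by omega)⟩

theorem notMem_of_mem_reach {T : Set V} {v : V} (h : v ∈ ω.reach T) : v ∉ T := by
  obtain ⟨R, -, rfl, hT⟩ := h
  exact hT 0

theorem reach_anti {S T : Set V} (h : S ⊆ T) : ω.reach T ⊆ ω.reach S := by
  rintro v ⟨R, hR, h0, hT⟩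
  exact ⟨R, hR, h0, fun n hn => hT n (h hn)⟩

/-- A ray of `ω` starting outside `reach T` meets `T`. -/
theorem exists_mem_of_notMem_reach {R : GraphRay G} (hR : R ∈ ω.rays) {T : Set V} {k : ℕ}
    (h : R.f k ∉ ω.reach T) : ∃ n ≥ k, R.f n ∈ T := by
  by_contra! hc
  exact h (mem_reach_of_ray hR hc)

theorem separatesFromEnd_of_disjoint_reach {X T : Set V} (h : Disjoint X (ω.reach T)) :
    SeparatesFromEnd G X T ω := by
  rintro R hR ⟨n, hn⟩
  obtain ⟨m, -, hm⟩ := exists_mem_of_notMem_reach hR (h.notMem_of_mem_left hn)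
  exact ⟨m, hm⟩

theorem mem_reach_of_adj {T : Set V} {u v : V} (hv : v ∈ ω.reach T) (hadj : G.Adj u v)
    (hu : u ∉ T) : u ∈ ω.reach T := by
  obtain ⟨R, hR, rfl, hT⟩ := hv
  by_cases h : ∃ n, R.f n = u
  · obtain ⟨n, rfl⟩ := h
    exact mem_reach_of_ray hR fun m _ => hT m
  · push Not at h
    refine ⟨R.cons u hadj h, ω.mem_rays_of_common_tail hR 1 0 fun _ => rfl, rfl, ?_⟩
    rintro (_ | n)
    · exact hu
    · exact hT n

theorem mem_reach_of_walk {T : Set V} {u v : V} (w : G.Walk u v) (hv : v ∈ ω.reach T)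
    (hw : ∀ x ∈ w.support, x ∉ T) : u ∈ ω.reach T := by
  induction w with
  | nil => exact hv
  | cons h p ih =>
    exact mem_reach_of_adj (ih hv fun x hx => hw x (by simp [hx])) h (hw _ (by simp))

theorem _root_.GraphRay.exists_walk {F : Set V} (R : GraphRay G) (hF : ∀ n, R.f n ∉ F) (n : ℕ) :
    ∃ w : G.Walk (R.f 0) (R.f n), ∀ x ∈ w.support, x ∉ F := by
  induction n with
  | zero => exact ⟨.nil, by simpa using hF 0⟩
  | succ n ih =>
    obtain ⟨w, hw⟩ := ih
    refine ⟨w.concat (R.adj n), fun x hx => ?_⟩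
    rw [SimpleGraph.Walk.support_concat, List.mem_append, List.mem_singleton] at hx
    rcases hx with hx | rfl
    · exact hw x hx
    · exact hF _

theorem exists_walk_of_mem_reach {F : Set V} (hF : F.Finite) {u v : V} (hu : u ∈ ω.reach F)
    (hv : v ∈ ω.reach F) : ∃ w : G.Walk u v, ∀ x ∈ w.support, x ∉ F := by
  obtain ⟨R, hR, rfl, hRF⟩ := hu
  obtain ⟨Q, hQ, rfl, hQF⟩ := hv
  obtain ⟨m, n, w, hw⟩ := (ω.mem_iff R hR Q).1 hQ F hF
  obtain ⟨w₁, hw₁⟩ := R.exists_walk hRF m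
  obtain ⟨w₂, hw₂⟩ := Q.exists_walk hQF n
  refine ⟨(w₁.append w).append w₂.reverse, fun x hx => ?_⟩
  simp only [SimpleGraph.Walk.mem_support_append_iff, SimpleGraph.Walk.support_reverse,
    List.mem_reverse] at hx
  rcases hx with (hx | hx) | hx
  · exact hw₁ x hx
  · exact hw x hx
  · exact hw₂ x hx

/-- A vertex that does not dominate `ω` can be separated from `ω` by finitely many other
vertices. -/
theorem exists_finite_of_not_dominates {v : V} (hv : ¬ Dominates G v ω) :
    ∃ S : Set V, S.Finite ∧ v ∉ S ∧ v ∉ ω.reach S := by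
  by_contra! hc
  apply hv
  obtain ⟨R₀, hR₀⟩ := ω.nonempty
  obtain ⟨N, hN⟩ := R₀.eventually_notMem (finite_singleton v)
  obtain ⟨R, hR, hRv⟩ : ∃ R ∈ ω.rays, ∀ n, R.f n ≠ v :=
    ⟨R₀.drop N, ω.drop_mem_rays hR₀ N, fun n => hN _ (by omega)⟩
  have : Std.Symm fun p q : (n : ℕ) × G.Walk v (R.f n) =>
      ∀ x, x ∈ p.2.support → x ∈ q.2.support → x = v := ⟨fun p q h x hx hy => h x hy hx⟩
  obtain ⟨p, hp, hpp⟩ := exists_seq_of_forall_finset_exists'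
    (α := (n : ℕ) × G.Walk v (R.f n)) (fun p => p.2.IsPath)
    (fun p q => ∀ x, x ∈ p.2.support → x ∈ q.2.support → x = v)
    (by
      classical
      intro s _
      have hS : (⋃ p ∈ s, {x | x ∈ p.2.support ∧ x ≠ v}).Finite :=
        s.finite_toSet.biUnion fun p _ => p.2.support.finite_toSet.subset fun x hx => hx.1
      have hvS := hc _ hS (by simp)
      obtain ⟨M, hM⟩ := R.eventually_notMem hS
      obtain ⟨w, hw⟩ := exists_walk_of_mem_reach hS hvS (mem_reach_of_ray hR hM)
      refine ⟨⟨M, w.bypass⟩, w.bypass_isPath, fun q hq x hxq hx => ?_⟩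
      by_contra hxv
      exact hw x (w.support_bypass_subset_support hx)
        (mem_biUnion (x := q) hq ⟨hxq, hxv⟩))
  refine ⟨R, hR, p, hp, fun i j hij => ?_, fun i j h => hpp h⟩
  by_contra hne
  refine hRv _ (hpp hne _ (SimpleGraph.Walk.end_mem_support _) ?_)
  have : (p i).1 = (p j).1 := hij
  rw [this]
  exact SimpleGraph.Walk.end_mem_support _

variable (ω) in
/-- No set of fewer vertices separates `A` from `ω`. -/
def IsTight (A : Finset V) : Prop :=
  ∀ Z : Finset V, Disjoint (A : Set V) (ω.reach Z) → A.card ≤ Z.card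

/-- A ray of `ω` starting in `A` and avoiding `T` yields such a ray meeting `A` only in its
first vertex. -/
theorem exists_ray_of_mem_reach {A : Set V} (hA : A.Finite) {T : Set V}
    (h : ¬ Disjoint A (ω.reach T)) :
    ∃ R ∈ ω.rays, R.f 0 ∈ A ∧ (∀ n, R.f n ∉ T) ∧ ∀ n, R.f (n + 1) ∉ A := by
  classical
  obtain ⟨a, ha, R, hR, rfl, hT⟩ := Set.not_disjoint_iff.1 h
  obtain ⟨N, hN⟩ := R.eventually_notMem hA
  have hle : ∀ n, R.f n ∈ A → n ≤ N := fun n hn => by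
    by_contra hlt
    exact hN n (by omega) hn
  have hk : R.f (Nat.findGreatest (fun n => R.f n ∈ A) N) ∈ A :=
    Nat.findGreatest_spec (P := fun n => R.f n ∈ A) (Nat.zero_le N) ha
  refine ⟨R.drop _, ω.drop_mem_rays hR (Nat.findGreatest (fun n => R.f n ∈ A) N), ?_,
    fun n => hT _, fun n hn => ?_⟩
  · simpa [GraphRay.drop] using hk
  · have := Nat.le_findGreatest (P := fun n => R.f n ∈ A) (hle _ hn) hn
    omega

/-- A finite set avoiding the dominating vertices can be separated from `ω` by a finite set
disjoint from it. -/
theorem exists_disjoint_separator {A : Finset V} (hA : ∀ a ∈ A, ¬ Dominates G a ω) :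
    ∃ S : Finset V, Disjoint A S ∧ Disjoint (A : Set V) (ω.reach S) := by
  classical
  choose! S hSf haS hS using fun a ha => exists_finite_of_not_dominates (hA a ha)
  have hfin : ((⋃ a ∈ A, S a) \ A).Finite :=
    (A.finite_toSet.biUnion fun a ha => hSf a ha).subset sdiff_subset
  refine ⟨hfin.toFinset, ?_, ?_⟩
  · rw [Finset.disjoint_left]
    intro a ha
    simp [ha]
  · by_contra h
    obtain ⟨R, hR, h0, hT, hA'⟩ := exists_ray_of_mem_reach A.finite_toSet h
    obtain ⟨n, -, hn⟩ := exists_mem_of_notMem_reach hR (hS _ h0)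
    have hn0 : n ≠ 0 := by
      rintro rfl
      exact haS _ h0 hn
    obtain ⟨n, rfl⟩ := Nat.exists_eq_succ_of_ne_zero hn0
    refine hT (n + 1) ?_
    rw [Finite.coe_toFinset]
    exact ⟨mem_biUnion h0 hn, hA' n⟩

/-- A smallest set separating a finite set from `ω`. -/
theorem exists_min_separator (S : Finset V) :
    ∃ T : Finset V, Disjoint (S : Set V) (ω.reach T) ∧
      ∀ Z : Finset V, Disjoint (S : Set V) (ω.reach Z) → T.card ≤ Z.card := by
  have hne : {T : Finset V | Disjoint (S : Set V) (ω.reach T)}.Nonempty :=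
    ⟨S, Set.disjoint_left.2 fun a ha h => notMem_of_mem_reach h ha⟩
  exact ⟨Function.argminOn Finset.card _ hne, Function.argminOn_mem Finset.card _ hne,
    fun Z hZ => Function.argminOn_le Finset.card _ (a := Z) hZ⟩

theorem disjoint_reach_trans {S T Z : Set V} (hST : Disjoint S (ω.reach T))
    (hTZ : Disjoint T (ω.reach Z)) : Disjoint S (ω.reach Z) := by
  rw [Set.disjoint_left] at *
  rintro s hs ⟨R, hR, rfl, hZ⟩
  obtain ⟨n, -, hn⟩ := exists_mem_of_notMem_reach hR (hST hs)
  exact hTZ hn (mem_reach_of_ray hR fun m _ => hZ m)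

theorem isTight_of_min_separator {S T : Finset V} (h : Disjoint (S : Set V) (ω.reach T))
    (hmin : ∀ Z : Finset V, Disjoint (S : Set V) (ω.reach Z) → T.card ≤ Z.card) :
    ω.IsTight T :=
  fun Z hZ => hmin Z (disjoint_reach_trans h hZ)

/-- In front of every finite set `A` avoiding the dominating vertices there is a tight separator
lying strictly closer to `ω`. -/
theorem exists_next_separator {A : Finset V} (hA : ∀ a ∈ A, ¬ Dominates G a ω) :
    ∃ B : Finset V, ω.IsTight B ∧ Disjoint (A : Set V) (ω.reach B) ∧
      (B : Set V) ⊆ ω.reach A := by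
  classical
  obtain ⟨S, hAS, hS⟩ := exists_disjoint_separator hA
  obtain ⟨B, hB, hmin⟩ := exists_min_separator (ω := ω) S
  refine ⟨B, isTight_of_min_separator hB hmin, disjoint_reach_trans hS hB, fun b hb => ?_⟩
  have hnd : ¬ Disjoint (S : Set V) (ω.reach (B.erase b : Finset V)) := fun h => by
    have := hmin _ h
    have := Finset.card_erase_lt_of_mem hb
    omega
  obtain ⟨s, hs, R, hR, rfl, hT⟩ := Set.not_disjoint_iff.1 hnd
  have key : ∀ n, R.f n ∈ B → R.f n = b := fun n hn => by
    by_contra hne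
    exact hT n (Finset.mem_coe.2 (Finset.mem_erase.2 ⟨hne, hn⟩))
  obtain ⟨k, -, hk⟩ := exists_mem_of_notMem_reach hR (hB.notMem_of_mem_left hs)
  have hkb := key k hk
  rw [← hkb]
  refine mem_reach_of_ray hR fun n hn hnA => ?_
  obtain ⟨m, hm, hmS⟩ := exists_mem_of_notMem_reach hR (hS.notMem_of_mem_left hnA)
  obtain ⟨l, hl, hlB⟩ := exists_mem_of_notMem_reach hR (hB.notMem_of_mem_left hmS)
  have hlk : l = k := R.inj ((key l hlB).trans hkb.symm)
  obtain rfl : n = m := by omega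
  exact Finset.disjoint_left.1 hAS hnA hmS

theorem reach_subset_reach {S T : Set V} (h : Disjoint S (ω.reach T)) :
    ω.reach T ⊆ ω.reach S := by
  rintro v ⟨R, hR, rfl, hT⟩
  exact ⟨R, hR, rfl, fun n hn => h.notMem_of_mem_left hn (mem_reach_of_ray hR fun m _ => hT m)⟩

/-- If every set of fewer than `k` elements misses a member of a family of finite sets, then this
is already so for some finite subfamily. -/
theorem _root_.Finset.exists_finite_subfamily_disjoint {α : Type u} (k : ℕ)
    (P : Finset α → Prop)
    (h : ∀ Z : Finset α, Z.card < k → ∃ F, P F ∧ Disjoint Z F) :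
    ∃ 𝓕 : Finset (Finset α), (∀ F ∈ 𝓕, P F) ∧
      ∀ Z : Finset α, Z.card < k → ∃ F ∈ 𝓕, Disjoint Z F := by
  classical
  induction k generalizing P with
  | zero => exact ⟨∅, by simp, by simp⟩
  | succ k ih =>
    obtain ⟨F₀, hF₀, -⟩ := h ∅ (by simp)
    have step : ∀ v : α, ∃ 𝓕 : Finset (Finset α), (∀ F ∈ 𝓕, P F ∧ v ∉ F) ∧
        ∀ Z : Finset α, Z.card < k → ∃ F ∈ 𝓕, Disjoint Z F := fun v => by
      refine ih (fun F => P F ∧ v ∉ F) fun Z hZ => ?_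
      obtain ⟨F, hF, hd⟩ := h (insert v Z) ((Finset.card_insert_le v Z).trans_lt (by omega))
      rw [Finset.disjoint_insert_left] at hd
      exact ⟨F, ⟨hF, hd.1⟩, hd.2⟩
    choose 𝓕 h𝓕 hd using step
    refine ⟨insert F₀ (F₀.biUnion 𝓕), ?_, fun Z hZ => ?_⟩
    · intro F hF
      rcases Finset.mem_insert.1 hF with rfl | hF
      · exact hF₀
      · obtain ⟨v, -, hv⟩ := Finset.mem_biUnion.1 hF
        exact (h𝓕 v F hv).1
    · by_cases hZF : Disjoint Z F₀
      · exact ⟨F₀, Finset.mem_insert_self _ _, hZF⟩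
      · obtain ⟨v, hvZ, hvF⟩ := Finset.not_disjoint_iff.1 hZF
        have hlt := Finset.card_erase_lt_of_mem hvZ
        obtain ⟨F, hF, hdF⟩ := hd v (Z.erase v) (by omega)
        refine ⟨F, Finset.mem_insert_of_mem (Finset.mem_biUnion.2 ⟨v, hvF, hF⟩), ?_⟩
        rw [← Finset.insert_erase hvZ, Finset.disjoint_insert_left]
        exact ⟨(h𝓕 v F hF).2, hdF⟩

/-- If fewer vertices than those of the tight set `A` are deleted, some path between `A` and a
separator `B` closer to `ω` survives. The path is recorded by its vertex set `F`: every vertex set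
containing the vertices of `A` in `F` and closed under adjacency in `F` meets `B`. -/
theorem IsTight.exists_link {A B : Finset V} (hA : ω.IsTight A)
    (hAB : Disjoint (A : Set V) (ω.reach B)) {Z : Finset V} (hZ : Z.card < A.card) :
    ∃ F : Finset V, ((∀ v ∈ F, v ∈ A ∨ v ∈ ω.reach A ∧ v ∉ ω.reach B) ∧
      ∀ S : Set V, (∀ v ∈ A, v ∈ F → v ∈ S) → (∀ u ∈ S, ∀ v ∈ F, G.Adj u v → v ∈ S) →
        ∃ b ∈ B, b ∈ S) ∧ Disjoint Z F := by
  classical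
  obtain ⟨R, hR, h0, hRZ, hRA⟩ := exists_ray_of_mem_reach A.finite_toSet
    (fun h => absurd (hA Z h) (by omega))
  have hex : ∃ n, R.f n ∈ B := by
    obtain ⟨n, -, hn⟩ := exists_mem_of_notMem_reach hR (hAB.notMem_of_mem_left h0)
    exact ⟨n, hn⟩
  have hout : ∀ j ≤ Nat.find hex, R.f j ∉ ω.reach B := by
    intro j hj
    induction j with
    | zero => exact hAB.notMem_of_mem_left h0
    | succ j ih =>
      exact fun h => ih (by omega) (mem_reach_of_adj h (R.adj j) (Nat.find_min hex (by omega)))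
  refine ⟨(Finset.range (Nat.find hex + 1)).image R.f, ⟨?_, ?_⟩, ?_⟩
  · intro v hv
    obtain ⟨j, hj, rfl⟩ := Finset.mem_image.1 hv
    rw [Finset.mem_range] at hj
    cases j with
    | zero => exact .inl h0
    | succ j =>
      refine .inr ⟨mem_reach_of_ray hR fun n hn => ?_, hout _ (by omega)⟩
      obtain ⟨i, rfl⟩ : ∃ i, n = i + 1 := ⟨n - 1, by omega⟩
      exact hRA i
  · intro S hAS hS
    refine ⟨_, Nat.find_spec hex, ?_⟩
    have hmem : ∀ j ≤ Nat.find hex, R.f j ∈ (Finset.range (Nat.find hex + 1)).image R.f :=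
      fun j hj => Finset.mem_image_of_mem _ (Finset.mem_range.2 (by omega))
    have : ∀ j ≤ Nat.find hex, R.f j ∈ S := by
      intro j hj
      induction j with
      | zero => exact hAS _ h0 (hmem _ hj)
      | succ j ih => exact hS _ (ih (by omega)) _ (hmem _ hj) (R.adj j)
    exact this _ le_rfl
  · rw [Finset.disjoint_right]
    intro v hv
    obtain ⟨j, -, rfl⟩ := Finset.mem_image.1 hv
    exact hRZ j

/-- A finite form of Menger's theorem between a tight set `A` and a separator `B` closer to `ω`:
following `f` from the vertices of `A` produces disjoint paths in the finite set `H`. -/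
theorem IsTight.exists_linkage {A B : Finset V} (hA : ω.IsTight A)
    (hAB : Disjoint (A : Set V) (ω.reach B)) :
    ∃ (H : Finset V) (f : V → V), A ⊆ H ∧
      (∀ v ∈ H, v ∈ A ∨ v ∈ ω.reach A ∧ v ∉ ω.reach B) ∧
      (∀ v ∈ H, v ∉ B → f v ∈ H ∧ f v ∉ A ∧ (f v = v ∨ G.Adj v (f v))) ∧
      ∀ u ∈ H, u ∉ B → ∀ v ∈ H, v ∉ B → f u = f v → u = v := by
  classical
  obtain ⟨𝓕, h𝓕, hlink⟩ := Finset.exists_finite_subfamily_disjoint A.card _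
    (fun Z hZ => hA.exists_link hAB hZ)
  set H : Finset V := A ∪ 𝓕.biUnion id
  have hFH : ∀ F ∈ 𝓕, F ⊆ H := fun F hF v hv =>
    Finset.mem_union_right _ (Finset.mem_biUnion.2 ⟨F, hF, hv⟩)
  let t : {v // v ∈ H \ B} → Finset V := fun v =>
    (H \ A).filter fun w => w = v ∨ G.Adj v w
  have hall : ∀ s : Finset {v // v ∈ H \ B}, s.card ≤ (s.biUnion t).card := by
    intro s
    by_contra! hlt
    set S : Finset V := s.map (Function.Embedding.subtype _)
    have hSH : ∀ v ∈ S, v ∈ H ∧ v ∉ B := fun v hv => by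
      obtain ⟨x, -, rfl⟩ := Finset.mem_map.1 hv
      simpa using Finset.mem_sdiff.1 x.2
    have ht : ∀ u ∈ S, ∀ w ∈ H, w ∉ A → w = u ∨ G.Adj u w → w ∈ s.biUnion t := by
      intro u hu w hw hwA huw
      obtain ⟨x, hx, rfl⟩ := Finset.mem_map.1 hu
      exact Finset.mem_biUnion.2 ⟨x, hx, Finset.mem_filter.2 ⟨Finset.mem_sdiff.2 ⟨hw, hwA⟩, huw⟩⟩
    have hSN : S ⊆ A ∪ s.biUnion t := fun v hv => by
      by_cases hvA : v ∈ A
      · exact Finset.mem_union_left _ hvA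
      · exact Finset.mem_union_right _ (ht v hv v (hSH v hv).1 hvA (.inl rfl))
    have hcard : ((A ∪ s.biUnion t) \ S).card < A.card := by
      have h₁ := Finset.card_sdiff_add_card_eq_card hSN
      have h₂ := Finset.card_union_le A (s.biUnion t)
      have h₃ : S.card = s.card := Finset.card_map _
      omega
    obtain ⟨F, hF, hdis⟩ := hlink _ hcard
    have hin : ∀ v ∈ F, v ∈ A ∪ s.biUnion t → v ∈ S := fun v hv hvN => by
      by_contra hvS
      exact Finset.disjoint_left.1 hdis (Finset.mem_sdiff.2 ⟨hvN, hvS⟩) hv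
    obtain ⟨b, hb, hbS⟩ := (h𝓕 F hF).2 S
      (fun v hv hvF => hin v hvF (Finset.mem_union_left _ hv))
      (fun u hu v hv huv => hin v hv (by
        by_cases hvA : v ∈ A
        · exact Finset.mem_union_left _ hvA
        · exact Finset.mem_union_right _ (ht u hu v (hFH F hF hv) hvA (.inr huv))))
    exact (hSH b hbS).2 hb
  obtain ⟨f, hf, hft⟩ := (Finset.all_card_le_biUnion_card_iff_exists_injective t).1 hall
  have hval : ∀ v (hv : v ∈ H \ B), (if h : v ∈ H \ B then f ⟨v, h⟩ else v) = f ⟨v, hv⟩ :=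
    fun v hv => dif_pos hv
  refine ⟨H, fun v => if h : v ∈ H \ B then f ⟨v, h⟩ else v, Finset.subset_union_left, ?_, ?_, ?_⟩
  · intro v hv
    rcases Finset.mem_union.1 hv with hv | hv
    · exact .inl hv
    · obtain ⟨F, hF, hvF⟩ := Finset.mem_biUnion.1 hv
      exact (h𝓕 F hF).1 v hvF
  · intro v hv hvB
    have hvHB := Finset.mem_sdiff.2 ⟨hv, hvB⟩
    have := hft ⟨v, hvHB⟩
    simp only [t, Finset.mem_filter, Finset.mem_sdiff] at this
    simp only [hval v hvHB]
    exact ⟨this.1.1, this.1.2, this.2⟩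
  · intro u hu huB v hv hvB huv
    have huHB := Finset.mem_sdiff.2 ⟨hu, huB⟩
    have hvHB := Finset.mem_sdiff.2 ⟨hv, hvB⟩
    simp only [hval u huHB, hval v hvHB] at huv
    exact congrArg Subtype.val (hf huv)

/-- Iterating an injective map that moves every vertex to itself or a neighbour yields disjoint
rays from the vertices outside its image. -/
theorem _root_.GraphRay.exists_disjoint_of_injOn {W A : Set V} {g : V → V} (hAW : A ⊆ W)
    (hmaps : MapsTo g W W) (hinj : InjOn g W) (hA : ∀ v ∈ W, g v ∉ A)
    (hadj : ∀ v ∈ W, g v = v ∨ G.Adj v (g v)) :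
    ∃ R : A → GraphRay G, (∀ a n, (R a).f n ∈ W) ∧
      ∀ a b, a ≠ b → Disjoint (range (R a).f) (range (R b).f) := by
  have hW : ∀ (a : A) n, g^[n] a ∈ W := fun a n => hmaps.iterate n (hAW a.2)
  have key : ∀ (a b : A) m n, g^[m] (a : V) = g^[n] (b : V) → m = n ∧ a = b := by
    intro a b m
    induction m with
    | zero =>
      rintro (_ | n) h
      · exact ⟨rfl, Subtype.ext h⟩
      · rw [Function.iterate_succ_apply'] at h
        exact absurd (h ▸ a.2) (hA _ (hW b n))
    | succ m ih =>
      rintro (_ | n) h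
      · rw [Function.iterate_succ_apply'] at h
        exact absurd (h ▸ b.2) (hA _ (hW a m))
      · rw [Function.iterate_succ_apply', Function.iterate_succ_apply'] at h
        obtain ⟨rfl, hab⟩ := ih n (hinj (hW a m) (hW b n) h)
        exact ⟨rfl, hab⟩
  refine ⟨fun a => ⟨fun n => g^[n] a, fun m n h => (key a a m n h).1, fun n => ?_⟩, hW, ?_⟩
  · have h := hadj _ (hW a n)
    rw [← Function.iterate_succ_apply' g n] at h
    exact h.resolve_left fun h => by
      have := (key a a _ _ h).1
      omega
  · intro a b hab
    rw [Set.disjoint_left]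
    rintro _ ⟨m, rfl⟩ ⟨n, h⟩
    exact hab (key b a n m h).2.symm

section Sequence

variable {T : ℕ → Finset V}

theorem reach_antitone (hdisj : ∀ n, Disjoint (T n : Set V) (ω.reach (T (n + 1)))) :
    Antitone fun n => ω.reach (T n) :=
  antitone_nat_of_succ_le fun n => reach_subset_reach (hdisj n)

theorem subset_reach_of_lt (hdisj : ∀ n, Disjoint (T n : Set V) (ω.reach (T (n + 1))))
    (hsub : ∀ n, (T (n + 1) : Set V) ⊆ ω.reach (T n)) {m n : ℕ} (h : m < n) :
    (T n : Set V) ∪ ω.reach (T n) ⊆ ω.reach (T m) := by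
  obtain ⟨k, rfl⟩ : ∃ k, n = k + 1 := ⟨n - 1, by omega⟩
  refine union_subset ((hsub k).trans (reach_antitone hdisj (by omega)))
    (reach_antitone hdisj h.le)

/-- Infinitely many disjoint nested separators leave every vertex behind. -/
theorem exists_notMem_reach (hdisj : ∀ n, Disjoint (T n : Set V) (ω.reach (T (n + 1))))
    (hsub : ∀ n, (T (n + 1) : Set V) ⊆ ω.reach (T n))
    (h0 : ¬ Disjoint (T 0 : Set V) (ω.reach ∅)) (v : V) : ∃ n, v ∉ ω.reach (T n) := by
  by_contra! hv
  obtain ⟨a, ha, har⟩ := Set.not_disjoint_iff.1 h0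
  obtain ⟨w, -⟩ := exists_walk_of_mem_reach finite_empty har
    (reach_anti (empty_subset _) (hv 0))
  have hmeet : ∀ n, ∃ x ∈ w.support, x ∈ T n := fun n => by
    by_contra! hc
    exact notMem_of_mem_reach
      (reach_antitone hdisj (Nat.zero_le n) (mem_reach_of_walk w (hv n) hc)) ha
  choose x hxw hxT using hmeet
  have hlt : ∀ m n, m < n → x m ≠ x n := fun m n hmn h =>
    notMem_of_mem_reach (subset_reach_of_lt hdisj hsub hmn (.inl (hxT n))) (h ▸ hxT m)
  have hinj : Function.Injective x := fun m n h => by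
    rcases lt_trichotomy m n with hmn | hmn | hmn
    · exact absurd h (hlt m n hmn)
    · exact hmn
    · exact absurd h.symm (hlt n m hmn)
  exact infinite_range_of_injective hinj
    (w.support.finite_toSet.subset (range_subset_iff.2 hxw))

theorem exists_disjoint_reach (hdisj : ∀ n, Disjoint (T n : Set V) (ω.reach (T (n + 1))))
    (hsub : ∀ n, (T (n + 1) : Set V) ⊆ ω.reach (T n))
    (h0 : ¬ Disjoint (T 0 : Set V) (ω.reach ∅)) {F : Set V} (hF : F.Finite) :
    ∃ n, Disjoint F (ω.reach (T n)) := by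
  choose N hN using exists_notMem_reach hdisj hsub h0
  obtain ⟨M, hM⟩ := (hF.image N).bddAbove
  refine ⟨M, Set.disjoint_left.2 fun v hv h => hN v ?_⟩
  exact reach_antitone hdisj (hM (mem_image_of_mem N hv)) h

/-- A ray meeting all the sets `reach (T n)` belongs to `ω`. -/
theorem mem_rays_of_forall_exists_mem_reach
    (hdisj : ∀ n, Disjoint (T n : Set V) (ω.reach (T (n + 1))))
    (hsub : ∀ n, (T (n + 1) : Set V) ⊆ ω.reach (T n))
    (h0 : ¬ Disjoint (T 0 : Set V) (ω.reach ∅)) {R : GraphRay G}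
    (hR : ∀ n, ∃ m, R.f m ∈ ω.reach (T n)) : R ∈ ω.rays := by
  obtain ⟨R₀, hR₀⟩ := ω.nonempty
  rw [ω.mem_iff R₀ hR₀]
  intro F hF
  obtain ⟨n, hn⟩ := exists_disjoint_reach hdisj hsub h0 hF
  obtain ⟨m, hm⟩ := hR n
  obtain ⟨N, hN⟩ := R₀.eventually_notMem hF
  obtain ⟨w, hw⟩ := exists_walk_of_mem_reach hF (mem_reach_of_ray hR₀ hN)
    (reach_subset_reach hn hm)
  exact ⟨N, m, w, hw⟩

end Sequence

/-- If no vertex dominates `ω`, then every tight set is matched by as many disjoint rays of `ω`. -/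
theorem IsTight.degGE (hdom : ∀ v, ¬ Dominates G v ω) {A : Finset V} (hA : ω.IsTight A) :
    DegGE G ω A.card := by
  classical
  choose next hnext₁ hnext₂ hnext₃ using
    fun A : Finset V => exists_next_separator (ω := ω) (A := A) fun a _ => hdom a
  set T : ℕ → Finset V := fun n => next^[n] A with hT
  have hTs : ∀ n, T (n + 1) = next (T n) := fun n => Function.iterate_succ_apply' _ _ _
  have htight : ∀ n, ω.IsTight (T n) := by
    rintro (_ | n)
    · exact hA
    · exact hTs n ▸ hnext₁ _
  have hdisj : ∀ n, Disjoint (T n : Set V) (ω.reach (T (n + 1))) :=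
    fun n => hTs n ▸ hnext₂ _
  have hsub : ∀ n, (T (n + 1) : Set V) ⊆ ω.reach (T n) := fun n => hTs n ▸ hnext₃ _
  clear_value T
  have hT0 : T 0 = A := by simp [hT]
  choose H f hTH hH hf hfinj using fun n => (htight n).exists_linkage (hdisj n)
  set L : ℕ → Set V := fun n => {v | v ∈ H n ∧ v ∉ T (n + 1)}
  have hL₁ : ∀ n, ∀ v ∈ L n, v ∈ (T n : Set V) ∪ ω.reach (T n) := fun n v hv =>
    (hH n v hv.1).imp id And.left
  have hL₂ : ∀ n, ∀ v ∈ L n, v ∉ (T (n + 1) : Set V) ∪ ω.reach (T (n + 1)) := by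
    rintro n v ⟨hvH, hvT⟩ (h | h)
    · exact hvT h
    · rcases hH n v hvH with hv | hv
      · exact (hdisj n).notMem_of_mem_left hv h
      · exact hv.2 h
  have hanti : ∀ m n, m < n → (T n : Set V) ∪ ω.reach (T n) ⊆
      (T (m + 1) : Set V) ∪ ω.reach (T (m + 1)) := fun m n hmn => by
    rcases (Nat.succ_le_of_lt hmn).eq_or_lt with rfl | h
    · exact Subset.rfl
    · exact (subset_reach_of_lt hdisj hsub h).trans subset_union_right
  have hLlt : ∀ m n v, v ∈ L m → v ∈ L n → ¬ m < n := fun m n v hm hn hmn =>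
    hL₂ m v hm (hanti m n hmn (hL₁ n v hn))
  have hLuniq : ∀ m n v, v ∈ L m → v ∈ L n → m = n := fun m n v hm hn => by
    have := hLlt m n v hm hn
    have := hLlt n m v hn hm
    omega
  obtain ⟨g, hg⟩ : ∃ g : V → V, ∀ n, ∀ v ∈ L n, g v = f n v := by
    refine ⟨fun v => if h : ∃ n, v ∈ L n then f h.choose v else v, fun n v hv => ?_⟩
    have h : ∃ n, v ∈ L n := ⟨n, hv⟩
    simp only [dif_pos h, hLuniq _ _ v h.choose_spec hv]
  have hTL : ∀ n, ∀ v ∈ T n, v ∈ L n := fun n v hv =>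
    ⟨hTH n hv, fun h => notMem_of_mem_reach (hsub n h) hv⟩
  have hgreach : ∀ n, ∀ v ∈ L n, g v ∈ ω.reach (T n) ∧ g v ∉ ω.reach (T (n + 1)) := by
    intro n v hv
    have hfv := hf n v hv.1 hv.2
    rw [hg n v hv]
    exact (hH n _ hfv.1).resolve_left hfv.2.1
  have hglt : ∀ m n u v, u ∈ L m → v ∈ L n → g u = g v → ¬ m < n :=
    fun m n u v hu hv huv hmn => (hgreach m u hu).2
      (huv ▸ reach_antitone hdisj (Nat.succ_le_of_lt hmn) (hgreach n v hv).1)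
  obtain ⟨R, hRW, hRdisj⟩ := GraphRay.exists_disjoint_of_injOn (G := G) (W := ⋃ n, L n)
    (A := (A : Set V)) (g := g)
    (fun a ha => mem_iUnion.2 ⟨0, hTL 0 a (hT0 ▸ ha)⟩)
    (fun v hv => by
      obtain ⟨n, hv⟩ := mem_iUnion.1 hv
      rw [mem_iUnion, hg n v hv]
      by_cases h : f n v ∈ T (n + 1)
      · exact ⟨n + 1, hTL _ _ h⟩
      · exact ⟨n, (hf n v hv.1 hv.2).1, h⟩)
    (fun u hu v hv huv => by
      obtain ⟨m, hu⟩ := mem_iUnion.1 hu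
      obtain ⟨n, hv⟩ := mem_iUnion.1 hv
      have h₁ := hglt m n u v hu hv huv
      have h₂ := hglt n m v u hv hu huv.symm
      obtain rfl : m = n := by omega
      rw [hg m u hu, hg m v hv] at huv
      exact hfinj m u hu.1 hu.2 v hv.1 hv.2 huv)
    (fun v hv hgA => by
      obtain ⟨n, hv⟩ := mem_iUnion.1 hv
      refine notMem_of_mem_reach (reach_antitone hdisj (Nat.zero_le n) (hgreach n v hv).1) ?_
      rwa [hT0])
    (fun v hv => by
      obtain ⟨n, hv⟩ := mem_iUnion.1 hv
      rw [hg n v hv]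
      exact (hf n v hv.1 hv.2).2.2)
  have hRω : ∀ a, R a ∈ ω.rays := fun a => by
    have h0 : ¬ Disjoint (T 0 : Set V) (ω.reach ∅) := fun h => by
      have h₁ := htight 0 ∅ (by simpa using h)
      have h₂ := Finset.card_pos.2 ⟨a.1, a.2⟩
      rw [hT0, Finset.card_empty] at h₁
      omega
    refine mem_rays_of_forall_exists_mem_reach hdisj hsub h0 fun n => ?_
    have hfin : (⋃ i ∈ Finset.range (n + 1), (H i : Set V)).Finite :=
      (Finset.range (n + 1)).finite_toSet.biUnion fun i _ => (H i).finite_toSet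
    obtain ⟨m, hm⟩ := (R a).eventually_notMem hfin
    obtain ⟨i, hi⟩ := mem_iUnion.1 (hRW a m)
    have hni : n < i := by
      by_contra hle
      exact hm m le_rfl (mem_biUnion (x := i) (Finset.mem_coe.2 (Finset.mem_range.2 (by omega)))
        hi.1)
    exact ⟨m, subset_reach_of_lt hdisj hsub hni (hL₁ i _ hi)⟩
  let e : Fin A.card ≃ (A : Set V) := A.equivFin.symm
  exact ⟨fun i => R (e i), fun i => hRω _, fun i j hij => hRdisj _ _ (e.injective.ne hij)⟩

/-- The graph `G` with all edges meeting `D` deleted. -/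
def _root_.SimpleGraph.isolate (G : SimpleGraph V) (D : Set V) : SimpleGraph V where
  Adj u v := G.Adj u v ∧ u ∉ D ∧ v ∉ D
  symm := ⟨fun _ _ h => ⟨h.1.symm, h.2.2, h.2.1⟩⟩
  loopless := ⟨fun _ h => G.loopless.irrefl _ h.1⟩

theorem _root_.SimpleGraph.isolate_le (G : SimpleGraph V) (D : Set V) : G.isolate D ≤ G :=
  fun _ _ h => h.1

/-- A ray of `G.isolate D`, viewed as a ray of `G`. -/
def _root_.GraphRay.ofIsolate {D : Set V} (R : GraphRay (G.isolate D)) : GraphRay G :=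
  ⟨R.f, R.inj, fun n => (R.adj n).1⟩

/-- A ray of `G` avoiding `D`, viewed as a ray of `G.isolate D`. -/
def _root_.GraphRay.toIsolate {D : Set V} (R : GraphRay G) (h : ∀ n, R.f n ∉ D) :
    GraphRay (G.isolate D) :=
  ⟨R.f, R.inj, fun n => ⟨R.adj n, h n, h (n + 1)⟩⟩

theorem _root_.SimpleGraph.Walk.exists_isolate {D : Set V} {u v : V} (w : G.Walk u v)
    (hw : ∀ x ∈ w.support, x ∉ D) : ∃ w' : (G.isolate D).Walk u v, w'.support = w.support := by
  refine ⟨w.transfer _ fun e he => ?_, by simp⟩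
  induction e with
  | h x y =>
    exact ⟨w.adj_of_mem_edges he, hw _ (w.fst_mem_support_of_mem_edges he),
      hw _ (w.snd_mem_support_of_mem_edges he)⟩

variable (ω) in
/-- The end induced by `ω` after deleting all edges meeting the finite set `D`. -/
def isolate {D : Set V} (hD : D.Finite) : GraphEnd (G.isolate D) where
  rays := {R | R.ofIsolate ∈ ω.rays}
  nonempty := by
    obtain ⟨R, hR⟩ := ω.nonempty
    obtain ⟨N, hN⟩ := R.eventually_notMem hD
    exact ⟨(R.drop N).toIsolate fun n => hN _ (by omega), ω.drop_mem_rays hR N⟩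
  mem_iff R hR R' := by
    rw [mem_ofPred_eq, ω.mem_iff _ hR]
    constructor
    · intro h F hF
      obtain ⟨m, n, w, hw⟩ := h (F ∪ D) (hF.union hD)
      obtain ⟨w', hw'⟩ := w.exists_isolate fun x hx h => hw x hx (.inr h)
      exact ⟨m, n, w', fun x hx h => hw x (hw' ▸ hx) (.inl h)⟩
    · intro h F hF
      obtain ⟨m, n, w, hw⟩ := h F hF
      exact ⟨m, n, w.mapLe (G.isolate_le D), (w.support_mapLe_eq_support _).symm ▸ hw⟩

theorem dominates_of_isolate {D : Set V} (hD : D.Finite) {v : V}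
    (h : Dominates (G.isolate D) v (ω.isolate hD)) : Dominates G v ω ∧ v ∉ D := by
  obtain ⟨R, hR, p, hp, hinj, hdisj⟩ := h
  refine ⟨⟨R.ofIsolate, hR, fun i => ⟨(p i).1, (p i).2.mapLe (G.isolate_le D)⟩,
    fun i => ?_, hinj, fun i j hij x hx hy => hdisj i j hij x ?_ ?_⟩, ?_⟩
  · exact (hp i).mapLe _
  · exact (p i).2.support_mapLe_eq_support (G.isolate_le D) ▸ hx
  · exact (p j).2.support_mapLe_eq_support (G.isolate_le D) ▸ hy
  · have key : ∀ {u w : V}, (G.isolate D).Walk u w → w ∉ D → u ∉ D := by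
      intro u w q hw
      cases q with
      | nil => exact hw
      | cons h _ => exact h.2.1
    exact key (p 0).2 (R.adj _).2.1

theorem degGE_of_isolate {D : Set V} (hD : D.Finite) {m : ℕ}
    (h : DegGE (G.isolate D) (ω.isolate hD) m) : DegGE G ω m := by
  obtain ⟨R, hR, hdisj⟩ := h
  exact ⟨fun i => (R i).ofIsolate, hR, hdisj⟩

theorem degGE_mono {m n : ℕ} (hmn : m ≤ n) (h : DegGE G ω n) : DegGE G ω m := by
  obtain ⟨R, hR, hdisj⟩ := h
  exact ⟨fun i => R (i.castLE hmn), fun i => hR _,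
    fun i j hij => hdisj _ _ ((Fin.castLE_injective hmn).ne hij)⟩

end GraphEnd

/-- a finite set can be separated from a finitely dominated end
`ω` by at most `deg(ω) + dom(ω)` vertices. -/
theorem separate_by_deg_add_dom {V : Type u} (G : SimpleGraph V) (ω : GraphEnd G)
    (hdom : {v : V | Dominates G v ω}.Finite) (X : Set V) (hX : X.Finite) :
    ∃ T : Finset V, SeparatesFromEnd G X (↑T) ω ∧ DegDomGE G ω T.card := by
  classical
  obtain ⟨T, hXT, hmin⟩ := GraphEnd.exists_min_separator (ω := ω.isolate hdom) hX.toFinset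
  rw [hX.coe_toFinset] at hXT
  have hdeg : DegGE G ω T.card := GraphEnd.degGE_of_isolate hdom <|
    (GraphEnd.isTight_of_min_separator (by rwa [hX.coe_toFinset]) hmin).degGE
      fun v hv => (GraphEnd.dominates_of_isolate hdom hv).2
        (GraphEnd.dominates_of_isolate hdom hv).1
  refine ⟨(T \ hdom.toFinset) ∪ hdom.toFinset, ?_, (T \ hdom.toFinset).card,
    hdom.toFinset.card, (Finset.card_union_of_disjoint Finset.sdiff_disjoint).symm,
    GraphEnd.degGE_mono (Finset.card_le_card Finset.sdiff_subset) hdeg,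
    hdom.toFinset, rfl, fun v hv => by simpa using hv⟩
  rintro R hR hRX
  rw [Finset.sdiff_union_self_eq_union]
  by_cases h : ∃ n, R.f n ∈ {v | Dominates G v ω}
  · obtain ⟨n, hn⟩ := h
    exact ⟨n, Finset.mem_union_right _ (hdom.mem_toFinset.2 hn)⟩
  · push Not at h
    obtain ⟨n, hn⟩ := GraphEnd.separatesFromEnd_of_disjoint_reach hXT (R.toIsolate h) hR hRX
    exact ⟨n, Finset.mem_union_left _ hn⟩
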